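/- arXiv:2402.18908 — 12 statements merged into one kernel-verified Lean document; each statement's English description precedes it below -/
import Mathlib

section
/- There exists a scaling function with a single discontinuity for which the optimal facility locations for total cost and maximum cost are not well-defined. Concretely, let q : [0,1] → ℝ be defined by q(y) = 1 for y ∈ [0, 1/2] and q(y) = 1/2 for y ∈ (1/2, 1], and let the agent profile be x = (0, 1/2, 1). Then the function y ↦ TC(q,y,x) attains no minimum on [0,1]: for every y ∈ [0,1] there exists y' ∈ [0,1] with TC(q,y',x) < TC(q,y,x). Likewise, the function y ↦ MC(q,y,x) attains no minimum on [0,1]. -/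
theorem sum_abs_sub_profile {y : ℝ} (hy : y ∈ Set.Icc (0 : ℝ) 1) :
    ∑ i, |y - (![0, 1/2, 1] : Fin 3 → ℝ) i| = 1 + |y - 1/2| := by
  obtain ⟨h0, h1⟩ := hy
  simp only [Fin.sum_univ_three, Matrix.cons_val]
  rw [abs_of_nonneg (by linarith : 0 ≤ y - 0), abs_of_nonpos (by linarith : y - 1 ≤ 0)]
  ring

theorem sup'_abs_sub_profile {y : ℝ} (hy : y ∈ Set.Icc (0 : ℝ) 1) :
    (Finset.univ.sup' Finset.univ_nonempty fun i => |y - (![0, 1/2, 1] : Fin 3 → ℝ) i|)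
      = max y (1 - y) := by
  obtain ⟨h0, h1⟩ := hy
  have hy0 : |y - 0| = y := by rw [sub_zero, abs_of_nonneg h0]
  have hy1 : |y - 1| = 1 - y := by rw [abs_sub_comm, abs_of_nonneg (by linarith)]
  apply le_antisymm
  · refine Finset.sup'_le _ _ fun i _ => ?_
    fin_cases i
    · exact hy0.le.trans (le_max_left _ _)
    · refine abs_le.2 ⟨?_, ?_⟩
      · have := le_max_right y (1 - y)
        simp only [Fin.mk_one, Matrix.cons_val]
        linarith
      · have := le_max_left y (1 - y)
        simp only [Fin.mk_one, Matrix.cons_val]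
        linarith
    · exact hy1.le.trans (le_max_right _ _)
  · refine max_le ?_ ?_
    · exact hy0.ge.trans (Finset.le_sup'
        (fun i => |y - (![0, 1/2, 1] : Fin 3 → ℝ) i|) (Finset.mem_univ 0))
    · exact hy1.ge.trans (Finset.le_sup'
        (fun i => |y - (![0, 1/2, 1] : Fin 3 → ℝ) i|) (Finset.mem_univ 2))

/-- For the discontinuous scaling function `q(y) = 1` on `[0,1/2]`, `q(y) = 1/2`
on `(1/2,1]`, and the agent profile `x = (0, 1/2, 1)`, neither the total cost
`y ↦ q(y) · Σᵢ |y - xᵢ|` nor the maximum cost `y ↦ q(y) · maxᵢ |y - xᵢ|` attains a minimum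
on `[0,1]`: every point is strictly beaten by some other point. -/
theorem stmt_0 (q : ℝ → ℝ) (hq : q = fun y => if y ≤ 1/2 then (1 : ℝ) else 1/2)
    (x : Fin 3 → ℝ) (hx : x = ![0, 1/2, 1]) :
    (∀ y ∈ Set.Icc (0:ℝ) 1, ∃ y' ∈ Set.Icc (0:ℝ) 1,
        q y' * ∑ i, |y' - x i| < q y * ∑ i, |y - x i|) ∧
    (∀ y ∈ Set.Icc (0:ℝ) 1, ∃ y' ∈ Set.Icc (0:ℝ) 1,
        q y' * (Finset.univ.sup' Finset.univ_nonempty fun i => |y' - x i|)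
          < q y * (Finset.univ.sup' Finset.univ_nonempty fun i => |y - x i|)) := by
  subst hq hx
  have improve : ∀ y ∈ Set.Icc (0 : ℝ) 1, ∃ z ∈ Set.Icc (0 : ℝ) 1,
      1/2 < z ∧ z ≤ 3/4 ∧ (1/2 < y → z < y) := by
    rintro y ⟨h0, h1⟩
    rcases le_or_gt y (1/2) with h | h
    · exact ⟨3/4, by norm_num, by norm_num, le_rfl, fun h' => absurd h' h.not_gt⟩
    · refine ⟨(y + 1/2) / 2, ⟨?_, ?_⟩, ?_, ?_, fun _ => ?_⟩ <;> linarith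
  constructor <;> intro y hy <;> obtain ⟨z, hz, hz_gt, hz_le, hzy⟩ := improve y hy <;>
    refine ⟨z, hz, ?_⟩
  · rw [sum_abs_sub_profile hy, sum_abs_sub_profile hz, abs_of_pos (sub_pos.2 hz_gt)]
    simp only [if_neg hz_gt.not_ge]
    split_ifs with h
    · linarith [abs_nonneg (y - 1/2)]
    · linarith [le_abs_self (y - 1/2), hzy (not_le.1 h)]
  · rw [sup'_abs_sub_profile hy, sup'_abs_sub_profile hz,
      max_eq_left (by linarith : 1 - z ≤ z)]
    simp only [if_neg hz_gt.not_ge]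
    split_ifs with h
    · linarith [le_max_right y (1 - y)]
    · linarith [le_max_left y (1 - y), hzy (not_le.1 h)]
end

section
/- Let q(y) = a·y + b be a linear scaling function with q(y) > 0 for all y ∈ [0,1], and let x_1 ≤ … ≤ x_n be agent locations in [0,1] with n ≥ 1. Let y₀ ∈ {0,1} be a point at which q attains its minimum over [0,1] (y₀ = 0 if a ≥ 0, y₀ = 1 if a ≤ 0). Then there exists y* ∈ {x_1,…,x_n} ∪ {y₀} such that TC(q, y*, x) ≤ TC(q, y, x) for all y ∈ [0,1]; that is, the total cost is minimized either at an agent's location or at the minimum point of q. -/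
/-- On an interval `[l, r]` with no point `x i` strictly inside, `y ↦ Σᵢ |y - xᵢ|` is affine. -/
theorem sum_abs_sub_affine {ι : Type*} [Fintype ι] (x : ι → ℝ) {l r y : ℝ}
    (hly : l ≤ y) (hyr : y ≤ r) (h : ∀ i, x i ≤ l ∨ r ≤ x i) :
    (r - l) * ∑ i, |y - x i| = (r - y) * ∑ i, |l - x i| + (y - l) * ∑ i, |r - x i| := by
  simp only [Finset.mul_sum, ← Finset.sum_add_distrib]
  refine Finset.sum_congr rfl fun i _ => ?_
  rcases h i with h | h
  · rw [abs_of_nonneg (by linarith), abs_of_nonneg (by linarith), abs_of_nonneg (by linarith)]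
    ring
  · rw [abs_of_nonpos (by linarith), abs_of_nonpos (by linarith), abs_of_nonpos (by linarith)]
    ring

/-- If the scaling function is nondecreasing, every location in `[0,1]` is weakly dominated
by an agent location or by `0`. -/
theorem exists_candidate_le {ι : Type*} [Fintype ι] (a b : ℝ) (ha : 0 ≤ a)
    (hq : ∀ y ∈ Set.Icc (0 : ℝ) 1, 0 < a * y + b) (x : ι → ℝ) {y : ℝ}
    (hy : y ∈ Set.Icc (0 : ℝ) 1) :
    ∃ z, (z ∈ Set.range x ∨ z = 0) ∧
      (a * z + b) * ∑ i, |z - x i| ≤ (a * y + b) * ∑ i, |y - x i| := by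
  classical
  obtain ⟨l, hl, hlmax⟩ := Finset.exists_max_image
    ((insert 0 (Finset.univ.image x)).filter (· ≤ y)) id ⟨0, by simp [hy.1]⟩
  simp only [Finset.mem_filter, Finset.mem_insert, Finset.mem_image, Finset.mem_univ, true_and,
    id] at hl hlmax
  obtain ⟨hlc, hly⟩ := hl
  have hl0 : 0 ≤ l := hlmax 0 ⟨Or.inl rfl, hy.1⟩
  have hlx : ∀ i, x i ≤ y → x i ≤ l := fun i hi => hlmax _ ⟨Or.inr ⟨i, rfl⟩, hi⟩
  have hql : 0 < a * l + b := hq l ⟨hl0, hly.trans hy.2⟩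
  have hqy : a * l + b ≤ a * y + b := by gcongr
  have hlz : l ∈ Set.range x ∨ l = 0 := hlc.symm
  by_cases hS : ∑ i, |l - x i| ≤ ∑ i, |y - x i|
  · exact ⟨l, hlz, mul_le_mul hqy hS (Finset.sum_nonneg fun i _ => abs_nonneg _)
      (hql.le.trans hqy)⟩
  have hne : ∃ i, y < x i := by
    by_contra! hall
    refine hS (Finset.sum_le_sum fun i _ => ?_)
    have h1 := hlx i (hall i)
    rw [abs_of_nonneg (by linarith), abs_of_nonneg (by linarith)]
    linarith
  obtain ⟨i₀, hi₀⟩ := hne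
  obtain ⟨j, hj, hjmin⟩ := Finset.exists_min_image
    (Finset.univ.filter fun i => y < x i) x ⟨i₀, by simp [hi₀]⟩
  simp only [Finset.mem_filter, Finset.mem_univ, true_and] at hj hjmin
  have haff := sum_abs_sub_affine x hly hj.le fun i =>
    (le_or_gt (x i) y).imp (hlx i) (hjmin i)
  by_contra! hcon
  have h1 := hcon l hlz
  have h2 := hcon (x j) (Or.inl ⟨j, rfl⟩)
  push Not at hS
  generalize (∑ i, |l - x i|) = L at *
  generalize (∑ i, |y - x i|) = Y at *
  generalize (∑ i, |x j - x i|) = R at *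
  generalize x j = r at *
  have hRL : (y - l) * (L - R) = (r - l) * (L - Y) := by linarith
  have hprod : 0 ≤ a * (r - y) * ((y - l) * (L - R)) := by
    rw [hRL]
    have : 0 ≤ r - l := by linarith
    have : 0 ≤ r - y := by linarith
    have : 0 ≤ L - Y := by linarith
    positivity
  have key : (r - l) * ((a * y + b) * Y) =
      (r - y) * ((a * l + b) * L) + (y - l) * ((a * r + b) * R)
        + a * (r - y) * ((y - l) * (L - R)) := by
    linear_combination (a * y + b) * haff
  have h3 : (r - y) * ((a * y + b) * Y) < (r - y) * ((a * l + b) * L) :=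
    mul_lt_mul_of_pos_left h1 (by linarith)
  have h4 : (y - l) * ((a * y + b) * Y) ≤ (y - l) * ((a * r + b) * R) :=
    mul_le_mul_of_nonneg_left h2.le (by linarith)
  linarith

/-- For a linear scaling function `q(y) = a·y + b`, positive on `[0,1]`, and
agent locations `x₀ ≤ … ≤ xₙ` in `[0,1]` (at least one agent), with `y₀ ∈ {0,1}` the minimum
point of `q` on `[0,1]` (`y₀ = 0` if `a ≥ 0`, `y₀ = 1` if `a ≤ 0`), the total cost
`y ↦ q(y) · Σᵢ |y - xᵢ|` is minimized over `[0,1]` at some agent location or at `y₀`. -/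
theorem stmt_1 (a b : ℝ) (hq : ∀ y ∈ Set.Icc (0:ℝ) 1, 0 < a * y + b)
    (n : ℕ) (x : Fin (n+1) → ℝ) (hx : ∀ i, x i ∈ Set.Icc (0:ℝ) 1) (hmono : Monotone x)
    (y₀ : ℝ) (hy₀ : (0 ≤ a ∧ y₀ = 0) ∨ (a ≤ 0 ∧ y₀ = 1)) :
    ∃ yStar, (yStar ∈ Set.range x ∨ yStar = y₀) ∧
      ∀ y ∈ Set.Icc (0:ℝ) 1,
        (a * yStar + b) * ∑ i, |yStar - x i| ≤ (a * y + b) * ∑ i, |y - x i| := by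
  classical
  have hdom : ∀ y ∈ Set.Icc (0 : ℝ) 1, ∃ z, (z ∈ Set.range x ∨ z = y₀) ∧
      (a * z + b) * ∑ i, |z - x i| ≤ (a * y + b) * ∑ i, |y - x i| := by
    intro y hy
    rcases hy₀ with ⟨ha, rfl⟩ | ⟨ha, rfl⟩
    · exact exists_candidate_le a b ha hq x hy
    · have hreflect : ∀ z, (-a * z + (a + b)) * ∑ i, |z - (1 - x i)| =
          (a * (1 - z) + b) * ∑ i, |(1 - z) - x i| := by
        intro z
        congr 1
        · ring
        · refine Finset.sum_congr rfl fun i _ => ?_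
          rw [← abs_neg]
          congr 1
          ring
      obtain ⟨z, hz, hle⟩ := exists_candidate_le (-a) (a + b) (by linarith)
        (fun t ht => by
          have := hq (1 - t) ⟨by linarith [ht.2], by linarith [ht.1]⟩
          linarith)
        (fun i => 1 - x i) (y := 1 - y) ⟨by linarith [hy.2], by linarith [hy.1]⟩
      rw [hreflect, hreflect, sub_sub_cancel] at hle
      refine ⟨1 - z, ?_, hle⟩
      rcases hz with ⟨i, rfl⟩ | rfl
      · exact Or.inl ⟨i, by simp⟩
      · exact Or.inr (by simp)
  obtain ⟨s, hs, hmin⟩ := Finset.exists_min_image (insert y₀ (Finset.univ.image x))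
    (fun z => (a * z + b) * ∑ i, |z - x i|) ⟨y₀, by simp⟩
  refine ⟨s, by simpa [or_comm] using hs, fun y hy => ?_⟩
  obtain ⟨z, hz, hle⟩ := hdom y hy
  exact (hmin z (by simpa [or_comm] using hz)).trans hle
end

section
/- The mechanism that outputs the facility location minimizing total cost is not strategyproof, even for a linear scaling function and 3 agents. Concretely, let q(y) = 1 − (4/5)·y, let x = (0.3, 0.4, 0.7), and let x' = (0.3, 0.4, 0.755) (agent 3 misreports 0.755 instead of 0.7). Then: (i) y = 0.4 is the unique minimizer of y ↦ TC(q, y, x) over [0,1], i.e., TC(q, 0.4, x) < TC(q, y, x) for all y ∈ [0,1] with y ≠ 0.4; (ii) y = 1 is the unique minimizer of y ↦ TC(q, y, x') over [0,1]; and (iii) agent 3's true cost strictly decreases by misreporting: q(1)·|1 − 0.7| < q(0.4)·|0.4 − 0.7|. -/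
/-- The optimal (total-cost-minimizing) mechanism is not strategyproof, even for
a linear scaling function and 3 agents. For `q(y) = 1 - (4/5)y`, true profile
`x = (0.3, 0.4, 0.7)` and misreported profile `x' = (0.3, 0.4, 0.755)`:
(i) `0.4` is the unique minimizer of the total cost for `x`;
(ii) `1` is the unique minimizer of the total cost for `x'`;
(iii) agent 3's true cost strictly decreases by the misreport. -/
theorem stmt_3 (q : ℝ → ℝ) (hq : q = fun y => 1 - (4/5) * y)
    (x x' : Fin 3 → ℝ) (hx : x = ![0.3, 0.4, 0.7]) (hx' : x' = ![0.3, 0.4, 0.755]) :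
    (∀ y ∈ Set.Icc (0:ℝ) 1, y ≠ 0.4 →
        q 0.4 * ∑ i, |(0.4 : ℝ) - x i| < q y * ∑ i, |y - x i|) ∧
    (∀ y ∈ Set.Icc (0:ℝ) 1, y ≠ 1 →
        q 1 * ∑ i, |(1 : ℝ) - x' i| < q y * ∑ i, |y - x' i|) ∧
    q 1 * |(1 : ℝ) - 0.7| < q 0.4 * |(0.4 : ℝ) - 0.7| := by
  subst hq hx hx'
  simp only [Fin.sum_univ_three, Matrix.cons_val_zero, Matrix.cons_val_one, Matrix.cons_val]
  refine ⟨?_, ?_, ?_⟩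
  · rintro y ⟨h0, h1⟩ hne
    norm_num [abs_of_pos, abs_of_neg] at hne ⊢
    rcases lt_or_gt_of_ne hne with h | h
    · rw [abs_of_neg (by linarith : y - 2 / 5 < 0), abs_of_neg (by linarith : y - 7 / 10 < 0)]
      rcases le_total y (3 / 10) with h3 | h3
      · rw [abs_of_nonpos (by linarith : y - 3 / 10 ≤ 0)]
        nlinarith
      · rw [abs_of_nonneg (by linarith : 0 ≤ y - 3 / 10)]
        nlinarith
    · rw [abs_of_pos (by linarith : 0 < y - 3 / 10), abs_of_pos (by linarith : 0 < y - 2 / 5)]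
      rcases le_total y (7 / 10) with h7 | h7
      · rw [abs_of_nonpos (by linarith : y - 7 / 10 ≤ 0)]
        nlinarith
      · rw [abs_of_nonneg (by linarith : 0 ≤ y - 7 / 10)]
        nlinarith
  · rintro y ⟨h0, h1⟩ hne
    have h : y < 1 := lt_of_le_of_ne h1 hne
    norm_num [abs_of_pos, abs_of_neg]
    rcases le_total y (2 / 5) with h4 | h4
    · rw [abs_of_nonpos (by linarith : y - 2 / 5 ≤ 0),
        abs_of_neg (by linarith : y - 151 / 200 < 0)]
      rcases le_total y (3 / 10) with h3 | h3
      · rw [abs_of_nonpos (by linarith : y - 3 / 10 ≤ 0)]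
        nlinarith
      · rw [abs_of_nonneg (by linarith : 0 ≤ y - 3 / 10)]
        nlinarith
    · rw [abs_of_pos (by linarith : 0 < y - 3 / 10), abs_of_nonneg (by linarith : 0 ≤ y - 2 / 5)]
      rcases le_total y (151 / 200) with h7 | h7
      · rw [abs_of_nonpos (by linarith : y - 151 / 200 ≤ 0)]
        nlinarith
      · rw [abs_of_nonneg (by linarith : 0 ≤ y - 151 / 200)]
        nlinarith
  · norm_num [abs_of_pos, abs_of_neg]
end

section
/- Let q(y) = a·y + b be a linear scaling function with q(y) > 0 for all y ∈ [0,1], and let x_1 ≤ … ≤ x_n be agent locations in [0,1] with n ≥ 1. Then there exists y* ∈ {0, (x_1 + x_n)/2, 1} such that MC(q, y*, x) ≤ MC(q, y, x) for all y ∈ [0,1]; that is, the maximum cost is minimized at 0, at the midpoint of the leftmost and rightmost agents, or at 1. -/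
/-- The farthest point of a sorted family is one of its two extreme points. -/
theorem sup'_abs_sub_eq_max {n : ℕ} {x : Fin (n + 1) → ℝ} (hmono : Monotone x) (y : ℝ) :
    (Finset.univ.sup' Finset.univ_nonempty fun i => |y - x i|) =
      max (y - x 0) (x (Fin.last n) - y) := by
  apply le_antisymm
  · refine Finset.sup'_le _ _ fun i _ => ?_
    have h0 := hmono (Fin.zero_le i)
    have h1 := hmono (Fin.le_last i)
    refine abs_le'.2 ⟨le_max_of_le_left (by linarith), le_max_of_le_right (by linarith)⟩
  · refine max_le ?_ ?_
    · exact (le_abs_self _).trans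
        (Finset.le_sup' (fun i => |y - x i|) (Finset.mem_univ 0))
    · refine le_trans ?_ (Finset.le_sup' (fun i => |y - x i|) (Finset.mem_univ (Fin.last n)))
      rw [abs_sub_comm]
      exact le_abs_self _

/-- On `[0, m]` with `m ≤ R`, the product of an affine function that is nonnegative at `m`
with `R - t` is bounded below by its value at `0` or at `m`. -/
theorem affine_mul_sub_endpoint_le {a b R m y : ℝ} (hy : 0 ≤ y) (hym : y ≤ m) (hmR : m ≤ R)
    (hm : 0 ≤ a * m + b) :
    b * R ≤ (a * y + b) * (R - y) ∨ (a * m + b) * (R - m) ≤ (a * y + b) * (R - y) := by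
  rcases le_total a 0 with ha | ha
  · right
    have h : a * m + b ≤ a * y + b := by nlinarith
    exact mul_le_mul h (by linarith) (by linarith) (hm.trans h)
  · by_contra! h
    obtain ⟨h0, h1⟩ := h
    rcases hy.eq_or_lt with rfl | hy
    · simp at h0
    · have hpos := mul_pos hy (sub_pos.2 h1)
      have hnonneg := mul_nonneg (sub_nonneg.2 hym) (sub_pos.2 h0).le
      have hquad := mul_nonneg (mul_nonneg ha hy.le)
        (mul_nonneg (sub_nonneg.2 hym) (hy.le.trans hym))
      linarith

/-- For a linear scaling function `q(y) = a·y + b`, positive on `[0,1]`, and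
agent locations `x₀ ≤ … ≤ xₙ` in `[0,1]` (at least one agent), the maximum cost
`y ↦ q(y) · maxᵢ |y - xᵢ|` is minimized over `[0,1]` at a point of
`{0, (x₁ + xₙ)/2, 1}` (0, the midpoint of the leftmost and rightmost agents, or 1). -/
theorem stmt_4 (a b : ℝ) (hq : ∀ y ∈ Set.Icc (0:ℝ) 1, 0 < a * y + b)
    (n : ℕ) (x : Fin (n+1) → ℝ) (hx : ∀ i, x i ∈ Set.Icc (0:ℝ) 1) (hmono : Monotone x) :
    ∃ yStar ∈ ({0, (x 0 + x (Fin.last n)) / 2, 1} : Set ℝ),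
      ∀ y ∈ Set.Icc (0:ℝ) 1,
        (a * yStar + b) * (Finset.univ.sup' Finset.univ_nonempty fun i => |yStar - x i|)
          ≤ (a * y + b) * (Finset.univ.sup' Finset.univ_nonempty fun i => |y - x i|) := by
  simp only [sup'_abs_sub_eq_max hmono]
  obtain ⟨hL0, hL1⟩ := hx 0
  obtain ⟨hR0, hR1⟩ := hx (Fin.last n)
  have hLR := hmono (Fin.zero_le (Fin.last n))
  generalize x 0 = L at *
  generalize x (Fin.last n) = R at *
  obtain ⟨z, hz, hmin⟩ := Set.exists_min_image ({0, (L + R) / 2, 1} : Set ℝ)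
    (fun t => (a * t + b) * max (t - L) (R - t)) (Set.toFinite _) ⟨0, by simp⟩
  refine ⟨z, hz, fun y ⟨hy0, hy1⟩ => ?_⟩
  have hz0 := hmin 0 (by simp)
  have hzm := hmin ((L + R) / 2) (by simp)
  have hz1 := hmin 1 (by simp)
  have hm := (hq ((L + R) / 2) ⟨by linarith, by linarith⟩).le
  rw [max_eq_right (a := 0 - L) (by linarith)] at hz0
  rw [max_eq_left (a := 1 - L) (by linarith)] at hz1
  rcases le_total y ((L + R) / 2) with h | h
  · rw [max_eq_right (a := (L + R) / 2 - L) (by linarith)] at hzm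
    rw [max_eq_right (a := y - L) (by linarith)]
    rcases affine_mul_sub_endpoint_le (R := R) hy0 h (by linarith) hm with h' | h' <;> linarith
  · rw [max_eq_left (a := (L + R) / 2 - L) (by linarith)] at hzm
    rw [max_eq_left (a := y - L) (by linarith)]
    rcases affine_mul_sub_endpoint_le (a := -a) (b := a + b) (R := 1 - L) (m := 1 - (L + R) / 2)
      (y := 1 - y) (by linarith) (by linarith) (by linarith) (by linarith) with h' | h' <;>
      linarith
end

section
/- The dictator mechanism has total cost approximation ratio at most (n−1)·r_q: let q : [0,1] → ℝ be a continuous scaling function with q(y) > 0 for all y, let n ≥ 2, let x_1 ≤ … ≤ x_n be agent locations in [0,1], and let j ∈ {1,…,n} be the dictator. Then for every y ∈ [0,1], q(x_j)·Σ_{i=1}^n |x_j − x_i| ≤ (n−1)·r_q·q(y)·Σ_{i=1}^n |y − x_i|. -/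
/-- The distances from one of `n ≥ 2` points to all of them sum to at most `n - 1` times the
sum of the distances from any other point. -/
theorem sum_abs_sub_le_card_sub_one_mul (n : ℕ) (hn : 2 ≤ n) (x : Fin n → ℝ) (j : Fin n)
    (y : ℝ) : ∑ i, |x j - x i| ≤ ((n : ℝ) - 1) * ∑ i, |y - x i| := by
  have hn' : (2 : ℝ) ≤ n := by exact_mod_cast hn
  have hcard : ((Finset.univ.erase j).card : ℝ) = (n : ℝ) - 1 := by
    rw [Finset.card_erase_of_mem (Finset.mem_univ j), Finset.card_univ, Fintype.card_fin,
      Nat.cast_sub (by omega), Nat.cast_one]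
  rw [← Finset.add_sum_erase _ _ (Finset.mem_univ j),
    ← Finset.add_sum_erase _ (fun i => |y - x i|) (Finset.mem_univ j)]
  have htri : ∑ i ∈ Finset.univ.erase j, |x j - x i| ≤
      ((n : ℝ) - 1) * |y - x j| + ∑ i ∈ Finset.univ.erase j, |y - x i| := by
    rw [← hcard, ← nsmul_eq_mul, ← Finset.sum_const, ← Finset.sum_add_distrib]
    refine Finset.sum_le_sum fun i _ => ?_
    simpa only [abs_sub_comm y (x j)] using abs_sub_le (x j) y (x i)
  have hnonneg : 0 ≤ ∑ i ∈ Finset.univ.erase j, |y - x i| :=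
    Finset.sum_nonneg fun i _ => abs_nonneg _
  rw [sub_self, abs_zero]
  nlinarith

/-- A positive continuous function on a compact set varies by at most the factor
`sSup / sInf`. -/
theorem IsCompact.le_sSup_div_sInf_mul {α : Type*} [TopologicalSpace α] {s : Set α}
    (hs : IsCompact s) {q : α → ℝ} (hcont : ContinuousOn q s) (hpos : ∀ y ∈ s, 0 < q y)
    {a b : α} (ha : a ∈ s) (hb : b ∈ s) :
    q a ≤ sSup (q '' s) / sInf (q '' s) * q b := by
  have hK : IsCompact (q '' s) := hs.image_of_continuousOn hcont
  have hm : 0 < sInf (q '' s) := by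
    obtain ⟨z, hz, hzeq⟩ := hK.sInf_mem ⟨q a, a, ha, rfl⟩
    exact hzeq ▸ hpos z hz
  have hM : q a ≤ sSup (q '' s) := le_csSup hK.bddAbove ⟨a, ha, rfl⟩
  have hmb : sInf (q '' s) ≤ q b := csInf_le hK.bddBelow ⟨b, hb, rfl⟩
  rw [div_mul_eq_mul_div, le_div_iff₀ hm]
  exact mul_le_mul hM hmb hm.le ((hpos a ha).le.trans hM)

/-- The dictator mechanism has total cost approximation ratio at most
`(n-1)·r_q`: for a continuous positive scaling function `q`, `n ≥ 2` agents
`x₁ ≤ … ≤ xₙ` in `[0,1]`, dictator `j`, and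
`r_q = (max_{[0,1]} q) / (min_{[0,1]} q)`, the dictator's total cost is at most
`(n-1)·r_q` times the total cost of any `y ∈ [0,1]`. -/
theorem stmt_6 (q : ℝ → ℝ) (hcont : ContinuousOn q (Set.Icc 0 1))
    (hpos : ∀ y ∈ Set.Icc (0:ℝ) 1, 0 < q y)
    (n : ℕ) (hn : 2 ≤ n) (x : Fin n → ℝ) (hx : ∀ i, x i ∈ Set.Icc (0:ℝ) 1)
    (hmono : Monotone x) (j : Fin n)
    (rq : ℝ) (hrq : rq = sSup (q '' Set.Icc 0 1) / sInf (q '' Set.Icc 0 1)) :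
    ∀ y ∈ Set.Icc (0:ℝ) 1,
      q (x j) * ∑ i, |x j - x i| ≤ ((n : ℝ) - 1) * rq * (q y * ∑ i, |y - x i|) := by
  intro y hy
  have hq : q (x j) ≤ rq * q y :=
    hrq ▸ isCompact_Icc.le_sSup_div_sInf_mul hcont hpos (hx j) hy
  calc q (x j) * ∑ i, |x j - x i|
      ≤ rq * q y * (((n : ℝ) - 1) * ∑ i, |y - x i|) :=
        mul_le_mul hq (sum_abs_sub_le_card_sub_one_mul n hn x j y)
          (Finset.sum_nonneg fun i _ => abs_nonneg _) ((hpos _ (hx j)).le.trans hq)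
    _ = ((n : ℝ) - 1) * rq * (q y * ∑ i, |y - x i|) := by ring
end

section
/- Let q : [0,1] → ℝ be continuous with q(y) > 0 for all y, and let D ⊆ [0,1] be a countable set such that at every y ∈ [0,1] \ D, q is differentiable (with derivative taken within [0,1]) and satisfies q(y) ≥ |q'(y)|. Then every agent's preference is single-peaked: for every x ∈ [0,1], the cost function y ↦ q(y)·|y − x| is nonincreasing on [0, x] and nondecreasing on [x, 1]. -/
open Set Filter Topology in
/-- A continuous function on `[a, b]` with positive derivative outside a countable set satisfies
`f a ≤ f b`. -/
theorem le_of_hasDerivAt_pos_off_countable {f f' : ℝ → ℝ} {a b : ℝ} (hab : a ≤ b) {D : Set ℝ}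
    (hD : D.Countable) (hf : ContinuousOn f (Icc a b))
    (hf' : ∀ y ∈ Ioo a b \ D, HasDerivAt f (f' y) y) (hpos : ∀ y ∈ Ioo a b \ D, 0 < f' y) :
    f a ≤ f b := by
  by_contra! hlt
  obtain ⟨c, hcD, hbc, hca⟩ : ∃ c ∈ (f '' D)ᶜ, f b < c ∧ c < f a := by
    obtain ⟨c, hc, h⟩ := ((hD.image f).dense_compl ℝ).exists_between hlt
    exact ⟨c, hc, h⟩
  set S : Set ℝ := Icc a b ∩ f ⁻¹' {c} with hS
  have hSc : IsCompact S :=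
    isCompact_Icc.of_isClosed_subset (hf.preimage_isClosed_of_isClosed isClosed_Icc
      isClosed_singleton) inter_subset_left
  have hSn : S.Nonempty := by
    obtain ⟨t, ht, htc⟩ := intermediate_value_Icc' hab hf ⟨hbc.le, hca.le⟩
    exact ⟨t, ht, htc⟩
  obtain ⟨t, ⟨ht, htc : f t = c⟩, htmax⟩ := hSc.exists_isGreatest hSn
  have hta : a < t := ht.1.lt_of_ne (by rintro rfl; exact hca.ne' htc)
  have htb : t < b := ht.2.lt_of_ne (by rintro rfl; exact hbc.ne htc)
  have htD : t ∈ Ioo a b \ D := ⟨⟨hta, htb⟩, fun h => hcD ⟨t, h, htc⟩⟩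
  have hslope : ∀ᶠ y in 𝓝[>] t, 0 < slope f t y :=
    ((hasDerivAt_iff_tendsto_slope.1 (hf' t htD)).mono_left
      (nhdsWithin_mono t fun y hy => ne_of_gt hy)).eventually_const_lt (hpos t htD)
  obtain ⟨y, hy, hty, hyb⟩ := (hslope.and (Ioo_mem_nhdsGT htb)).exists
  rw [slope_def_field, div_pos_iff_of_pos_right (sub_pos.2 hty), htc, sub_pos] at hy
  obtain ⟨s, hs, hsc⟩ := intermediate_value_Icc' hyb.le
    (hf.mono (Icc_subset_Icc_left (hta.trans hty).le)) ⟨hbc.le, hy.le⟩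
  have : s ≤ t := htmax ⟨⟨(hta.trans hty).le.trans hs.1, hs.2⟩, hsc⟩
  linarith [hs.1]

open Set in
/-- A continuous function on `[a, b]` with nonnegative derivative outside a countable set is
monotone on `[a, b]`. -/
theorem monotoneOn_of_hasDerivAt_nonneg_off_countable {f f' : ℝ → ℝ} {a b : ℝ} {D : Set ℝ}
    (hD : D.Countable) (hf : ContinuousOn f (Icc a b))
    (hf' : ∀ y ∈ Ioo a b \ D, HasDerivAt f (f' y) y) (hnonneg : ∀ y ∈ Ioo a b \ D, 0 ≤ f' y) :
    MonotoneOn f (Icc a b) := by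
  intro u hu v hv huv
  have hsub : Ioo u v \ D ⊆ Ioo a b \ D := sdiff_subset_sdiff_left (Ioo_subset_Ioo hu.1 hv.2)
  have key : ∀ ε > 0, f u + ε * u ≤ f v + ε * v := fun ε hε =>
    le_of_hasDerivAt_pos_off_countable (f := fun y => f y + ε * y) (f' := fun y => f' y + ε * 1)
      huv hD ((hf.mono (Icc_subset_Icc hu.1 hv.2)).add (by fun_prop))
      (fun y hy => (hf' y (hsub hy)).add ((hasDerivAt_id y).const_mul ε))
      (fun y hy => by linarith [hnonneg y (hsub hy)])
  refine le_of_forall_pos_le_add fun ε hε => ?_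
  have hd : 0 < v - u + 1 := by linarith
  have h := key (ε / (v - u + 1)) (by positivity)
  have h' : ε / (v - u + 1) * (v - u) ≤ ε := by
    rw [div_mul_eq_mul_div, div_le_iff₀ hd]
    nlinarith
  linarith

/-- If `q` is continuous and positive on `[0,1]` and, outside a countable set
`D`, differentiable within `[0,1]` with `|q'(y)| ≤ q(y)`, then every agent's preference is
single-peaked: for every `x ∈ [0,1]`, the cost `y ↦ q(y)·|y - x|` is nonincreasing on
`[0, x]` and nondecreasing on `[x, 1]`. -/
theorem stmt_9 (q q' : ℝ → ℝ) (hcont : ContinuousOn q (Set.Icc 0 1))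
    (hpos : ∀ y ∈ Set.Icc (0:ℝ) 1, 0 < q y)
    (D : Set ℝ) (hD : D.Countable)
    (hderiv : ∀ y ∈ Set.Icc (0:ℝ) 1 \ D, HasDerivWithinAt q (q' y) (Set.Icc 0 1) y)
    (hcond : ∀ y ∈ Set.Icc (0:ℝ) 1 \ D, |q' y| ≤ q y) :
    ∀ x ∈ Set.Icc (0:ℝ) 1,
      AntitoneOn (fun y => q y * |y - x|) (Set.Icc 0 x) ∧
      MonotoneOn (fun y => q y * |y - x|) (Set.Icc x 1) := by
  intro x hx
  have hmono : MonotoneOn (fun y => q y * (y - x)) (Set.Icc 0 1) := by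
    refine monotoneOn_of_hasDerivAt_nonneg_off_countable
      (f' := fun y => q' y * (y - x) + q y * 1) hD (hcont.mul (by fun_prop)) ?_ ?_
    · intro y hy
      exact ((hderiv y ⟨Set.Ioo_subset_Icc_self hy.1, hy.2⟩).hasDerivAt
        (Icc_mem_nhds hy.1.1 hy.1.2)).mul ((hasDerivAt_id y).sub_const x)
    · intro y hy
      have hy' : y ∈ Set.Icc (0 : ℝ) 1 := Set.Ioo_subset_Icc_self hy.1
      have hdist : |y - x| ≤ 1 := abs_le.2 ⟨by linarith [hy'.1, hx.2], by linarith [hy'.2, hx.1]⟩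
      have hprod : |q' y * (y - x)| ≤ q y := by
        rw [abs_mul]
        exact (mul_le_of_le_one_right (abs_nonneg _) hdist).trans (hcond y ⟨hy', hy.2⟩)
      linarith [neg_abs_le (q' y * (y - x))]
  constructor
  · intro u hu v hv huv
    have h := hmono ⟨hu.1, hu.2.trans hx.2⟩ ⟨hv.1, hv.2.trans hx.2⟩ huv
    simp only [abs_of_nonpos (sub_nonpos.2 hu.2), abs_of_nonpos (sub_nonpos.2 hv.2)] at h ⊢
    linarith
  · intro u hu v hv huv
    have h := hmono ⟨hx.1.trans hu.1, hu.2⟩ ⟨hx.1.trans hv.1, hv.2⟩ huv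
    simpa only [abs_of_nonneg (sub_nonneg.2 hu.1), abs_of_nonneg (sub_nonneg.2 hv.1)] using h
end

section
/- Let q(y) = a·y + b be a linear scaling function with q(y) > 0 for all y ∈ [0,1] (equivalently b > 0 and a + b > 0). Then every agent's preference is single-peaked for every possible agent location — i.e., for every x ∈ [0,1] the function y ↦ (a·y + b)·|y − x| is nonincreasing on [0, x] and nondecreasing on [x, 1] — if and only if (a > 0 implies b ≥ a) and (a < 0 implies b ≥ −2a). -/
/-- For a linear scaling function `q(y) = a·y + b`, positive on `[0,1]`, every
agent's preference is single-peaked for every agent location `x ∈ [0,1]` (i.e.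
`y ↦ (a·y + b)·|y - x|` is nonincreasing on `[0,x]` and nondecreasing on `[x,1]`) if and only
if (`a > 0` implies `b ≥ a`) and (`a < 0` implies `b ≥ -2a`). -/
theorem stmt_10 (a b : ℝ) (hpos : ∀ y ∈ Set.Icc (0:ℝ) 1, 0 < a * y + b) :
    (∀ x ∈ Set.Icc (0:ℝ) 1,
        AntitoneOn (fun y => (a * y + b) * |y - x|) (Set.Icc 0 x) ∧
        MonotoneOn (fun y => (a * y + b) * |y - x|) (Set.Icc x 1)) ↔
      ((0 < a → a ≤ b) ∧ (a < 0 → -2 * a ≤ b)) := by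
  have hb : 0 < b := by simpa using hpos 0 (by simp)
  have hab : 0 < a + b := by simpa using hpos 1 (by simp)
  constructor
  · intro h
    constructor
    · intro ha
      by_contra! hlt
      obtain ⟨z, hz⟩ : ∃ z, 2 * a * z = a - b := ⟨(a - b) / (2 * a), by field_simp⟩
      have hz0 : 0 < z := by
        by_contra! hn
        nlinarith
      have hz1 : z ≤ 1 := by
        by_contra! hn
        nlinarith
      have key := (h 1 (by simp)).1 (show (0 : ℝ) ∈ Set.Icc 0 1 by simp)
        (show z ∈ Set.Icc 0 1 from ⟨hz0.le, hz1⟩) hz0.le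
      simp only [abs_of_nonpos (sub_nonpos.2 hz1),
        abs_of_nonpos (sub_nonpos.2 (zero_le_one' ℝ))] at key
      nlinarith [mul_pos ha (mul_pos hz0 hz0)]
    · intro ha
      by_contra! hlt
      obtain ⟨y, hy⟩ : ∃ y, 2 * a * y = -b := ⟨-b / (2 * a), mul_div_cancel₀ _ (mul_ne_zero two_ne_zero ha.ne)⟩
      have hy0 : 0 ≤ y := by
        by_contra! hn
        nlinarith
      have hy1 : y < 1 := by
        by_contra! hn
        nlinarith
      have key := (h 0 (by simp)).2 (show y ∈ Set.Icc 0 1 from ⟨hy0, hy1.le⟩)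
        (show (1 : ℝ) ∈ Set.Icc 0 1 by simp) hy1.le
      simp only [sub_zero, abs_of_nonneg hy0, abs_one] at key
      nlinarith [mul_pos (neg_pos.2 ha) (mul_pos (sub_pos.2 hy1) (sub_pos.2 hy1))]
  · rintro ⟨h₁, h₂⟩ x ⟨hx0, hx1⟩
    constructor
    · rintro y ⟨hy0, hyx⟩ z ⟨hz0, hzx⟩ hyz
      have slope : 0 ≤ a * (y + z - x) + b := by
        rcases lt_trichotomy a 0 with ha | rfl | ha
        · nlinarith
        · linarith
        · nlinarith [h₁ ha]
      simp only [abs_of_nonpos (sub_nonpos.2 hyx), abs_of_nonpos (sub_nonpos.2 hzx)]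
      nlinarith [mul_nonneg (sub_nonneg.2 hyz) slope]
    · rintro y ⟨hxy, hy1⟩ z ⟨hxz, hz1⟩ hyz
      have slope : 0 ≤ a * (y + z - x) + b := by
        rcases lt_trichotomy a 0 with ha | rfl | ha
        · nlinarith [h₂ ha]
        · linarith
        · nlinarith
      simp only [abs_of_nonneg (sub_nonneg.2 hxy), abs_of_nonneg (sub_nonneg.2 hxz)]
      nlinarith [mul_nonneg (sub_nonneg.2 hyz) slope]
end

section
/- Let q : [0,1] → ℝ be a continuous, positive, piecewise linear scaling function with breakpoints 0 = s_0 < s_1 < … < s_k = 1 and q(y) = a_j·y + b_j for y ∈ [s_{j−1}, s_j], for each j = 1,…,k. If for every j it holds that (a_j > 0 implies b_j ≥ a_j) and (a_j < 0 implies b_j ≥ −2a_j), then every agent's preference is single-peaked: for every x ∈ [0,1], the cost function y ↦ q(y)·|y − x| is nonincreasing on [0, x] and nondecreasing on [x, 1]. -/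
/-- A function that is monotone on the part of an order-connected set `T` lying in each segment of
a partition is monotone on the part of `T` lying in the whole partitioned interval. -/
theorem monotoneOn_inter_Icc_of_segments {α β : Type*} [LinearOrder α] [Preorder β] {f : α → β}
    {T : Set α} [hT : T.OrdConnected] {k : ℕ} {s : Fin (k + 1) → α}
    (hf : ∀ j : Fin k, MonotoneOn f (T ∩ Set.Icc (s j.castSucc) (s j.succ))) (i : Fin (k + 1)) :
    MonotoneOn f (T ∩ Set.Icc (s 0) (s i)) := by
  induction i using Fin.induction with
  | zero =>
    rintro y ⟨-, hy0, hy1⟩ z ⟨-, hz0, hz1⟩ -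
    rw [le_antisymm hy1 hy0, le_antisymm hz1 hz0]
  | succ i ih =>
    rintro y ⟨hyT, hy0, hy1⟩ z ⟨hzT, hz0, hz1⟩ hyz
    rcases le_total z (s i.castSucc) with hz | hz
    · exact ih ⟨hyT, hy0, hyz.trans hz⟩ ⟨hzT, hz0, hz⟩ hyz
    rcases le_total (s i.castSucc) y with hy | hy
    · exact hf i ⟨hyT, hy, hy1⟩ ⟨hzT, hz, hz1⟩ hyz
    have hmid : s i.castSucc ∈ T := hT.out hyT hzT ⟨hy, hz⟩
    exact (ih ⟨hyT, hy0, hy⟩ ⟨hmid, hy0.trans hy, le_rfl⟩ hy).trans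
      (hf i ⟨hmid, le_rfl, hz.trans hz1⟩ ⟨hzT, hz, hz1⟩ hz)

/-- To the right of the agent's location, the cost with affine scaling is nondecreasing. -/
theorem affine_mul_sub_le {a b x y z : ℝ} (hpos : 0 < a * y + b)
    (hb : a < 0 → -2 * a ≤ b) (hx : 0 ≤ x) (hxy : x ≤ y) (hyz : y ≤ z) (hz : z ≤ 1) :
    (a * y + b) * (y - x) ≤ (a * z + b) * (z - x) := by
  have hslope : 0 ≤ a * (y + z - x) + b := by
    rcases lt_or_ge a 0 with h | h
    · nlinarith [hb h]
    · nlinarith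
  nlinarith [mul_nonneg (sub_nonneg.2 hyz) hslope]

/-- To the left of the agent's location, the cost with affine scaling is nonincreasing. -/
theorem affine_mul_sub_ge {a b x y z : ℝ} (hpos : 0 < a * y + b)
    (hb : (0 < a → a ≤ b) ∧ (a < 0 → -2 * a ≤ b)) (hy : 0 ≤ y) (hyz : y ≤ z) (hzx : z ≤ x)
    (hx : x ≤ 1) :
    (a * z + b) * (x - z) ≤ (a * y + b) * (x - y) := by
  have hslope : 0 ≤ a * (y + z - x) + b := by
    rcases lt_trichotomy a 0 with h | rfl | h
    · nlinarith [hb.2 h]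
    · linarith
    · nlinarith [hb.1 h]
  nlinarith [mul_nonneg (sub_nonneg.2 hyz) hslope]

/-- Let `q` be a continuous, positive, piecewise linear scaling function with
breakpoints `0 = s₀ < s₁ < … < s_k = 1` and `q(y) = aⱼ·y + bⱼ` on `[s_{j-1}, s_j]`. If for
every segment (`aⱼ > 0` implies `bⱼ ≥ aⱼ`) and (`aⱼ < 0` implies `bⱼ ≥ -2aⱼ`), then every
agent's preference is single-peaked: for every `x ∈ [0,1]`, the cost `y ↦ q(y)·|y - x|` is
nonincreasing on `[0, x]` and nondecreasing on `[x, 1]`. -/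
theorem stmt_11 (q : ℝ → ℝ) (hcont : ContinuousOn q (Set.Icc 0 1))
    (hpos : ∀ y ∈ Set.Icc (0:ℝ) 1, 0 < q y)
    (k : ℕ) (s : Fin (k+1) → ℝ) (hs : StrictMono s) (hs0 : s 0 = 0)
    (hsk : s (Fin.last k) = 1) (a b : Fin k → ℝ)
    (haffine : ∀ j : Fin k, ∀ y ∈ Set.Icc (s j.castSucc) (s j.succ), q y = a j * y + b j)
    (hcond : ∀ j : Fin k, (0 < a j → a j ≤ b j) ∧ (a j < 0 → -2 * a j ≤ b j)) :
    ∀ x ∈ Set.Icc (0:ℝ) 1,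
      AntitoneOn (fun y => q y * |y - x|) (Set.Icc 0 x) ∧
      MonotoneOn (fun y => q y * |y - x|) (Set.Icc x 1) := by
  rintro x ⟨hx0, hx1⟩
  constructor
  · have h := monotoneOn_inter_Icc_of_segments (T := Set.Icc 0 x) (s := s)
      (f := fun y => OrderDual.toDual (q y * |y - x|)) (fun j => ?_) (Fin.last k)
    · rw [hs0, hsk, Set.inter_eq_left.2 (Set.Icc_subset_Icc_right hx1)] at h
      exact h
    · rintro y ⟨⟨hy0, hyx⟩, hy⟩ z ⟨⟨hz0, hzx⟩, hz⟩ hyz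
      have hq := hpos y ⟨hy0, hyx.trans hx1⟩
      rw [haffine j y hy] at hq
      simp only [OrderDual.toDual_le_toDual]
      rw [haffine j y hy, haffine j z hz, abs_of_nonpos (sub_nonpos.2 hyx),
        abs_of_nonpos (sub_nonpos.2 hzx), neg_sub, neg_sub]
      exact affine_mul_sub_ge hq (hcond j) hy0 hyz hzx hx1
  · have h := monotoneOn_inter_Icc_of_segments (T := Set.Icc x 1) (s := s)
      (f := fun y => q y * |y - x|) (fun j => ?_) (Fin.last k)
    · rwa [hs0, hsk, Set.inter_eq_left.2 (Set.Icc_subset_Icc_left hx0)] at h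
    · rintro y ⟨⟨hxy, hy1⟩, hy⟩ z ⟨⟨hxz, hz1⟩, hz⟩ hyz
      have hq := hpos y ⟨hx0.trans hxy, hy1⟩
      rw [haffine j y hy] at hq
      simp only
      rw [haffine j y hy, haffine j z hz, abs_of_nonneg (sub_nonneg.2 hxy),
        abs_of_nonneg (sub_nonneg.2 hxz)]
      exact affine_mul_sub_le hq (hcond j).2 hx0 hxy hyz hz1
end

section
/- When all agents' preferences are single-peaked, every phantom mechanism is strategyproof. That is, let q : [0,1] → ℝ satisfy q(y) > 0 for all y, and suppose that for every x ∈ [0,1] the cost function y ↦ q(y)·|y − x| is nonincreasing on [0, x] and nondecreasing on [x, 1]. Fix n ≥ 1 and phantom values p_1 ≤ … ≤ p_{n+1} in [0,1], and let f(x) be the median (the (n+1)-th smallest) of the 2n+1 numbers x_1,…,x_n,p_1,…,p_{n+1}. Then for every profile x ∈ [0,1]^n, every agent i, and every misreport x_i' ∈ [0,1], writing x' for the profile with x_i replaced by x_i', we have q(f(x))·|f(x) − x_i| ≤ q(f(x'))·|f(x') − x_i|. -/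
/-- The median of a list of `2m+1` reals: the `(m+1)`-th smallest element. -/
noncomputable def medOf (l : List ℝ) : ℝ :=
  (List.insertionSort (· ≤ ·) l).getD (l.length / 2) 0

theorem List.getElem_le_iff_lt_countP {s : List ℝ} (hs : s.Pairwise (· ≤ ·)) (t : ℝ) (k : ℕ)
    (hk : k < s.length) : s[k] ≤ t ↔ k < s.countP (· ≤ t) := by
  induction s generalizing k with
  | nil => simp at hk
  | cons a s ih =>
    rw [List.pairwise_cons] at hs
    by_cases ha : a ≤ t
    · cases k with
      | zero => simp [ha]
      | succ k => simpa [ha] using ih hs.2 k (by simpa using hk)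
    · have hcount : s.countP (· ≤ t) = 0 :=
        List.countP_eq_zero.2 fun b hb => by simpa using (not_le.1 ha).trans_le (hs.1 b hb)
      have hat : t < (a :: s)[k] := by
        cases k with
        | zero => simpa using ha
        | succ k => exact (not_le.1 ha).trans_le (hs.1 _ (List.getElem_mem _))
      simp [ha, hcount, hat]

theorem medOf_eq_getElem {l : List ℝ} (hl : l ≠ []) :
    ∃ h : l.length / 2 < (l.insertionSort (· ≤ ·)).length,
      medOf l = (l.insertionSort (· ≤ ·))[l.length / 2] := by
  have h : l.length / 2 < (l.insertionSort (· ≤ ·)).length := by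
    have := List.length_pos_iff.2 hl
    rw [List.length_insertionSort]
    omega
  exact ⟨h, List.getD_eq_getElem _ _ h⟩

theorem medOf_mem {l : List ℝ} (hl : l ≠ []) : medOf l ∈ l := by
  obtain ⟨h, e⟩ := medOf_eq_getElem hl
  rw [e]
  exact (List.mem_insertionSort _).1 (List.getElem_mem h)

theorem medOf_le_iff {l : List ℝ} (hl : l ≠ []) (t : ℝ) :
    medOf l ≤ t ↔ l.length / 2 < l.countP (· ≤ t) := by
  obtain ⟨h, e⟩ := medOf_eq_getElem hl
  rw [e, List.getElem_le_iff_lt_countP (List.pairwise_insertionSort _ _),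
    (List.perm_insertionSort _ l).countP_eq]

theorem List.countP_ofFn_le_countP_ofFn {n : ℕ} {f g : Fin n → ℝ} {t : ℝ}
    (h : ∀ j, f j ≤ t → g j ≤ t) :
    (List.ofFn f).countP (· ≤ t) ≤ (List.ofFn g).countP (· ≤ t) := by
  induction n with
  | zero => simp
  | succ n ih =>
    have ht := ih fun j => h j.succ
    have h0 := h 0
    simp only [List.ofFn_succ, List.countP_cons, decide_eq_true_eq]
    split_ifs <;> first | omega | tauto

theorem medOf_ofFn_append_le {n : ℕ} {f g : Fin (n + 1) → ℝ} {l : List ℝ} {t : ℝ}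
    (h : ∀ j, f j ≤ t → g j ≤ t) (hf : medOf (List.ofFn f ++ l) ≤ t) :
    medOf (List.ofFn g ++ l) ≤ t := by
  rw [medOf_le_iff (by simp)] at hf ⊢
  simp only [List.length_append, List.length_ofFn, List.countP_append] at hf ⊢
  have := List.countP_ofFn_le_countP_ofFn h
  omega

theorem medOf_ofFn_append_ofFn_mem {n m : ℕ} {f : Fin (n + 1) → ℝ} {g : Fin m → ℝ} {s : Set ℝ}
    (hf : ∀ j, f j ∈ s) (hg : ∀ j, g j ∈ s) : medOf (List.ofFn f ++ List.ofFn g) ∈ s := by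
  have h := medOf_mem (l := List.ofFn f ++ List.ofFn g) (by simp)
  rw [List.mem_append, List.mem_ofFn, List.mem_ofFn] at h
  rcases h with ⟨j, hj⟩ | ⟨j, hj⟩
  · exact hj ▸ hf j
  · exact hj ▸ hg j

/-- If the positive scaling function `q` makes every agent's preference
single-peaked (for every `x ∈ [0,1]`, `y ↦ q(y)·|y - x|` is nonincreasing on `[0,x]` and
nondecreasing on `[x,1]`), then every phantom mechanism — which, given `n+1 ≥ 1` agents and
sorted phantoms `p₀ ≤ … ≤ p_{n+1}` in `[0,1]`, outputs the median (the `(n+2)`-th smallest)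
of the `2n+3` numbers `x₀,…,xₙ,p₀,…,p_{n+1}` — is strategyproof: no agent can strictly
decrease her cost by misreporting. -/
theorem stmt_12 (q : ℝ → ℝ) (hpos : ∀ y ∈ Set.Icc (0:ℝ) 1, 0 < q y)
    (hsp : ∀ x ∈ Set.Icc (0:ℝ) 1,
      AntitoneOn (fun y => q y * |y - x|) (Set.Icc 0 x) ∧
      MonotoneOn (fun y => q y * |y - x|) (Set.Icc x 1))
    (n : ℕ) (p : Fin (n+2) → ℝ) (hp : Monotone p) (hp01 : ∀ i, p i ∈ Set.Icc (0:ℝ) 1) :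
    ∀ x : Fin (n+1) → ℝ, (∀ i, x i ∈ Set.Icc (0:ℝ) 1) →
      ∀ i : Fin (n+1), ∀ xi' ∈ Set.Icc (0:ℝ) 1,
        q (medOf (List.ofFn x ++ List.ofFn p)) *
            |medOf (List.ofFn x ++ List.ofFn p) - x i|
          ≤ q (medOf (List.ofFn (Function.update x i xi') ++ List.ofFn p)) *
            |medOf (List.ofFn (Function.update x i xi') ++ List.ofFn p) - x i| := by
  intro x hx i xi' hxi'
  have hm := medOf_ofFn_append_ofFn_mem hx hp01
  have hm' : medOf (List.ofFn (Function.update x i xi') ++ List.ofFn p) ∈ Set.Icc (0:ℝ) 1 := by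
    refine medOf_ofFn_append_ofFn_mem (fun j => ?_) hp01
    rcases eq_or_ne j i with rfl | hj
    · simpa using hxi'
    · simpa [hj] using hx j
  obtain ⟨hanti, hmono⟩ := hsp (x i) (hx i)
  rcases lt_trichotomy (medOf (List.ofFn x ++ List.ofFn p)) (x i) with h | h | h
  · have hle := medOf_ofFn_append_le (g := Function.update x i xi') (fun j hj => by
      have hji : j ≠ i := by
        rintro rfl
        exact absurd hj h.not_ge
      simpa [hji] using hj) (le_refl (medOf (List.ofFn x ++ List.ofFn p)))
    exact hanti ⟨hm'.1, hle.trans h.le⟩ ⟨hm.1, h.le⟩ hle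
  · rw [h, sub_self, abs_zero, mul_zero]
    exact mul_nonneg (hpos _ hm').le (abs_nonneg _)
  · have hmax := medOf_ofFn_append_le (f := Function.update x i xi') (g := x) (fun j hj => by
      rcases eq_or_ne j i with rfl | hji
      · exact le_max_right _ _
      · simpa [hji] using hj)
      (le_max_left (medOf (List.ofFn (Function.update x i xi') ++ List.ofFn p)) (x i))
    have hle := (le_max_iff.1 hmax).resolve_right h.not_ge
    exact hmono ⟨h.le, hm.2⟩ ⟨h.le.trans hle, hm'.2⟩ hle
end

section
/- If the scaling function guarantees single-peaked preferences then the ratio between its maximum and minimum values is at most e. That is, let q : [0,1] → ℝ be continuous with q(y) > 0 for all y, and let D ⊆ [0,1] be a countable set such that at every y ∈ [0,1] \ D, q is differentiable (with derivative taken within [0,1]) and satisfies q(y) ≥ |q'(y)|. Then for all y_1, y_2 ∈ [0,1], q(y_2) ≤ e·q(y_1); in particular r_q = (max_{y∈[0,1]} q(y))/(min_{y∈[0,1]} q(y)) ≤ e. -/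
/-- Mean value inequality for a continuous function on a segment whose derivative exists and is
bounded off a countable set. -/
lemma abs_sub_le_of_abs_deriv_le_off_countable {f f' : ℝ → ℝ} {a b C : ℝ} (hab : a ≤ b)
    {s : Set ℝ} (hs : s.Countable) (hf : ContinuousOn f (Set.Icc a b))
    (hderiv : ∀ x ∈ Set.Ioo a b \ s, HasDerivAt f (f' x) x)
    (hbound : ∀ x ∈ Set.Ioo a b \ s, |f' x| ≤ C) : |f b - f a| ≤ C * (b - a) := by
  have hd : ∀ x ∈ Set.Ioo a b \ s, HasDerivAt f (deriv f x) x := fun x hx =>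
    (hderiv x hx).differentiableAt.hasDerivAt
  have hae : ∀ᵐ x, x ∈ Set.Ioc a b → ‖deriv f x‖ ≤ C := by
    have hnull : MeasureTheory.volume (insert b s) = 0 := (hs.insert b).measure_zero _
    filter_upwards [MeasureTheory.measure_eq_zero_iff_ae_notMem.1 hnull] with x hx hxI
    rw [Set.mem_insert_iff, not_or] at hx
    have hxm : x ∈ Set.Ioo a b \ s := ⟨⟨hxI.1, lt_of_le_of_ne hxI.2 hx.1⟩, hx.2⟩
    rw [(hderiv x hxm).deriv]
    exact hbound x hxm
  have hint : IntervalIntegrable (deriv f) MeasureTheory.volume a b := by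
    rw [intervalIntegrable_iff_integrableOn_Ioc_of_le hab]
    refine MeasureTheory.Integrable.mono' (g := fun _ => C)
      (MeasureTheory.integrable_const C) (measurable_deriv f).aestronglyMeasurable ?_
    rwa [MeasureTheory.ae_restrict_iff' measurableSet_Ioc]
  rw [← MeasureTheory.integral_eq_of_hasDerivAt_off_countable_of_le f (deriv f) hab hs hf hd hint]
  have h := intervalIntegral.norm_integral_le_of_norm_le_const_ae (a := a) (b := b)
    (f := deriv f) (C := C) (by rwa [Set.uIoc_of_le hab])
  rwa [Real.norm_eq_abs, abs_of_nonneg (sub_nonneg.2 hab)] at h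

/-- If `q` is continuous and positive on `[0,1]` and, outside a countable set
`D`, differentiable within `[0,1]` with `|q'(y)| ≤ q(y)` (the condition guaranteeing
single-peaked preferences), then `q(y₂) ≤ e·q(y₁)` for all `y₁, y₂ ∈ [0,1]`; in particular
`r_q = (max_{[0,1]} q) / (min_{[0,1]} q) ≤ e`. -/
theorem stmt_13 (q q' : ℝ → ℝ) (hcont : ContinuousOn q (Set.Icc 0 1))
    (hpos : ∀ y ∈ Set.Icc (0:ℝ) 1, 0 < q y)
    (D : Set ℝ) (hD : D.Countable)
    (hderiv : ∀ y ∈ Set.Icc (0:ℝ) 1 \ D, HasDerivWithinAt q (q' y) (Set.Icc 0 1) y)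
    (hcond : ∀ y ∈ Set.Icc (0:ℝ) 1 \ D, |q' y| ≤ q y) :
    (∀ y₁ ∈ Set.Icc (0:ℝ) 1, ∀ y₂ ∈ Set.Icc (0:ℝ) 1, q y₂ ≤ Real.exp 1 * q y₁) ∧
    sSup (q '' Set.Icc 0 1) / sInf (q '' Set.Icc 0 1) ≤ Real.exp 1 := by
  have hlog : ∀ a ∈ Set.Icc (0:ℝ) 1, ∀ b ∈ Set.Icc (0:ℝ) 1, a ≤ b →
      |Real.log (q b) - Real.log (q a)| ≤ 1 := by
    intro a ha b hb hab
    have hsub : Set.Icc a b ⊆ Set.Icc 0 1 := Set.Icc_subset_Icc ha.1 hb.2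
    have hmem : ∀ x ∈ Set.Ioo a b \ D, x ∈ Set.Icc (0:ℝ) 1 \ D := fun x hx =>
      ⟨hsub (Set.Ioo_subset_Icc_self hx.1), hx.2⟩
    have h := abs_sub_le_of_abs_deriv_le_off_countable (f := fun x => Real.log (q x))
      (f' := fun x => q' x / q x) (C := 1) hab hD
      ((hcont.mono hsub).log fun x hx => (hpos x (hsub hx)).ne')
      (fun x hx => ((hderiv x (hmem x hx)).hasDerivAt
        (Icc_mem_nhds (ha.1.trans_lt hx.1.1) (hx.1.2.trans_le hb.2))).log
          (hpos x (hmem x hx).1).ne')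
      (fun x hx => by
        have hx0 := hpos x (hmem x hx).1
        rw [abs_div, abs_of_pos hx0, div_le_one hx0]
        exact hcond x (hmem x hx))
    linarith [ha.1, hb.2]
  have hle : ∀ y₁ ∈ Set.Icc (0:ℝ) 1, ∀ y₂ ∈ Set.Icc (0:ℝ) 1, q y₂ ≤ Real.exp 1 * q y₁ := by
    intro y₁ h₁ y₂ h₂
    have h : Real.log (q y₂) - Real.log (q y₁) ≤ 1 := by
      rcases le_total y₁ y₂ with h | h
      · exact (abs_le.1 (hlog y₁ h₁ y₂ h₂ h)).2
      · linarith [(abs_le.1 (hlog y₂ h₂ y₁ h₁ h)).1]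
    rw [← Real.exp_log (hpos y₂ h₂), ← Real.exp_log (hpos y₁ h₁), ← Real.exp_add]
    exact Real.exp_le_exp.2 (by linarith)
  refine ⟨hle, ?_⟩
  have hne : (Set.Icc (0:ℝ) 1).Nonempty := Set.nonempty_Icc.2 zero_le_one
  obtain ⟨m, hm, hmin⟩ := isCompact_Icc.exists_sInf_image_eq hne hcont
  obtain ⟨M, hM, hmax⟩ := isCompact_Icc.exists_sSup_image_eq hne hcont
  rw [hmin, hmax, div_le_iff₀ (hpos m hm)]
  exact hle m hm M hM
end

section
/- Let q : [0,1] → ℝ be a continuous, positive, piecewise linear scaling function with k segments: there are breakpoints 0 = s_0 < s_1 < … < s_k = 1 with q(y) = a_j·y + b_j for y ∈ [s_{j−1}, s_j], for j = 1,…,k. Suppose q satisfies the single-peakedness condition q(y) ≥ |q'(y)| on every segment, i.e., a_j·y + b_j ≥ |a_j| for all y ∈ [s_{j−1}, s_j] and all j. Then for all y_1, y_2 ∈ [0,1], q(y_2) ≤ (1 + 1/k)^k · q(y_1); in particular r_q = (max_{y∈[0,1]} q(y))/(min_{y∈[0,1]} q(y)) ≤ (1 + 1/k)^k. -/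
/-- An affine function dominating the absolute value of its slope at `u` grows by a factor of at
most `1 + |v - u|` between `u` and `v`. -/
theorem affine_le_one_add_abs_mul {a b u v : ℝ} (h : |a| ≤ a * u + b) :
    a * v + b ≤ (1 + |v - u|) * (a * u + b) := by
  have h1 : a * (v - u) ≤ |a| * |v - u| := by
    rw [← abs_mul]; exact le_abs_self _
  nlinarith [mul_le_mul_of_nonneg_right h (abs_nonneg (v - u))]

/-- The quantitative form of AM-GM for a single factor. -/
theorem one_add_le_mul_exp {c x : ℝ} (hc : 0 < c) : 1 + x ≤ c * Real.exp ((1 + x - c) / c) := by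
  have h := mul_le_mul_of_nonneg_left (Real.add_one_le_exp ((1 + x - c) / c)) hc.le
  have h2 : c * ((1 + x - c) / c + 1) = 1 + x := by field_simp; ring
  linarith

/-- A sequence growing by factors `1 + (p (j+1) - p j)`, along which `p` increases by at most `1`
in total, grows by a factor of at most `(1 + 1/k)^k`. -/
theorem le_one_add_inv_pow_mul {k : ℕ} (hk : 0 < k) (p g : Fin (k + 1) → ℝ)
    (hg : ∀ j, 0 ≤ g j) (hp : p (Fin.last k) - p 0 ≤ 1)
    (hstep : ∀ j : Fin k, g j.succ ≤ (1 + (p j.succ - p j.castSucc)) * g j.castSucc) :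
    g (Fin.last k) ≤ (1 + 1 / (k : ℝ)) ^ k * g 0 := by
  have hk' : (0 : ℝ) < k := by exact_mod_cast hk
  set c : ℝ := 1 + 1 / (k : ℝ) with hc
  have hc0 : 0 < c := by positivity
  have key : ∀ j : Fin (k + 1),
      g j ≤ c ^ (j : ℕ) * Real.exp ((p j - p 0 - (j : ℕ) * (1 / (k : ℝ))) / c) * g 0 := by
    intro j
    induction j using Fin.induction with
    | zero => simp
    | succ j ih =>
      calc g j.succ ≤ (1 + (p j.succ - p j.castSucc)) * g j.castSucc := hstep j
        _ ≤ c * Real.exp ((1 + (p j.succ - p j.castSucc) - c) / c) * g j.castSucc :=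
          mul_le_mul_of_nonneg_right (one_add_le_mul_exp hc0) (hg _)
        _ ≤ c * Real.exp ((1 + (p j.succ - p j.castSucc) - c) / c) *
            (c ^ (j : ℕ) * Real.exp ((p j.castSucc - p 0 - (j : ℕ) * (1 / (k : ℝ))) / c) * g 0) :=
          mul_le_mul_of_nonneg_left ih (by positivity)
        _ = c ^ ((j : ℕ) + 1) * (Real.exp ((1 + (p j.succ - p j.castSucc) - c) / c) *
            Real.exp ((p j.castSucc - p 0 - (j : ℕ) * (1 / (k : ℝ))) / c)) * g 0 := by ring
        _ = _ := by
          rw [← Real.exp_add, ← add_div, Fin.val_succ]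
          congr 4
          rw [hc]
          push_cast
          ring
  refine (key (Fin.last k)).trans (mul_le_mul_of_nonneg_right ?_ (hg 0))
  rw [Fin.val_last]
  refine mul_le_of_le_one_right (by positivity) (Real.exp_le_one_iff.2 ?_)
  refine div_nonpos_of_nonpos_of_nonneg ?_ hc0.le
  rw [mul_one_div_cancel hk'.ne']
  linarith

/-- The clamps of two reals `s ≤ t` to an interval coincide or both lie in `[s, t]`. -/
theorem clamp_eq_or_mem_Icc {x y s t : ℝ} (hxy : x ≤ y) (hst : s ≤ t) :
    max x (min s y) = max x (min t y) ∨
      max x (min s y) ∈ Set.Icc s t ∧ max x (min t y) ∈ Set.Icc s t := by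
  simp only [Set.mem_Icc]
  grind

/-- Let `q` be a continuous, positive, piecewise linear scaling function with
`k` segments: breakpoints `0 = s₀ < s₁ < … < s_k = 1` and `q(y) = aⱼ·y + bⱼ` on
`[s_{j-1}, s_j]`. If `q` satisfies the single-peakedness condition `q(y) ≥ |q'(y)|` on every
segment, i.e. `aⱼ·y + bⱼ ≥ |aⱼ|` on `[s_{j-1}, s_j]` for every `j`, then
`q(y₂) ≤ (1 + 1/k)^k · q(y₁)` for all `y₁, y₂ ∈ [0,1]`; in particular
`r_q = (max_{[0,1]} q) / (min_{[0,1]} q) ≤ (1 + 1/k)^k`. -/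
theorem stmt_14 (q : ℝ → ℝ) (hcont : ContinuousOn q (Set.Icc 0 1))
    (hpos : ∀ y ∈ Set.Icc (0:ℝ) 1, 0 < q y)
    (k : ℕ) (hk : 0 < k) (s : Fin (k+1) → ℝ) (hs : StrictMono s) (hs0 : s 0 = 0)
    (hsk : s (Fin.last k) = 1) (a b : Fin k → ℝ)
    (haffine : ∀ j : Fin k, ∀ y ∈ Set.Icc (s j.castSucc) (s j.succ), q y = a j * y + b j)
    (hcond : ∀ j : Fin k, ∀ y ∈ Set.Icc (s j.castSucc) (s j.succ), |a j| ≤ a j * y + b j) :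
    (∀ y₁ ∈ Set.Icc (0:ℝ) 1, ∀ y₂ ∈ Set.Icc (0:ℝ) 1,
        q y₂ ≤ (1 + 1 / (k : ℝ)) ^ k * q y₁) ∧
    sSup (q '' Set.Icc 0 1) / sInf (q '' Set.Icc 0 1) ≤ (1 + 1 / (k : ℝ)) ^ k := by
  have hratio : ∀ j : Fin k, ∀ u ∈ Set.Icc (s j.castSucc) (s j.succ),
      ∀ v ∈ Set.Icc (s j.castSucc) (s j.succ), q v ≤ (1 + |v - u|) * q u := by
    intro j u hu v hv
    rw [haffine j u hu, haffine j v hv]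
    exact affine_le_one_add_abs_mul (hcond j u hu)
  have hbound : ∀ x ∈ Set.Icc (0:ℝ) 1, ∀ y ∈ Set.Icc (0:ℝ) 1, x ≤ y →
      q y ≤ (1 + 1 / (k : ℝ)) ^ k * q x ∧ q x ≤ (1 + 1 / (k : ℝ)) ^ k * q y := by
    intro x hx y hy hxy
    set p : Fin (k + 1) → ℝ := fun j => max x (min (s j) y) with hp
    have hp0 : p 0 = x := by simp [hp, hs0, hx.1]
    have hpk : p (Fin.last k) = y := by simp [hp, hsk, hy.2, hxy]
    have hpq : ∀ j, 0 < q (p j) := fun j =>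
      hpos _ ⟨hx.1.trans (le_max_left _ _), max_le hx.2 ((min_le_right _ _).trans hy.2)⟩
    have hpm : ∀ j : Fin k, p j.castSucc ≤ p j.succ := fun j =>
      max_le_max_left _ (min_le_min_right _ (hs j.castSucc_lt_succ).le)
    have hlen : p (Fin.last k) - p 0 ≤ 1 := by
      rw [hp0, hpk]; linarith [hx.1, hy.2]
    have hstep : ∀ j : Fin k,
        q (p j.succ) ≤ (1 + (p j.succ - p j.castSucc)) * q (p j.castSucc) ∧
        q (p j.castSucc) ≤ (1 + (p j.succ - p j.castSucc)) * q (p j.succ) := by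
      intro j
      rcases clamp_eq_or_mem_Icc hxy (hs j.castSucc_lt_succ).le with h | ⟨h₁, h₂⟩
      · have h' : p j.castSucc = p j.succ := h
        simp [h']
      · have e := abs_of_nonneg (sub_nonneg.2 (hpm j))
        have r₁ := hratio j _ h₁ _ h₂
        have r₂ := hratio j _ h₂ _ h₁
        rw [abs_sub_comm] at r₂
        rw [← e]
        exact ⟨r₁, r₂⟩
    have hup := le_one_add_inv_pow_mul hk p (fun j => q (p j)) (fun j => (hpq j).le) hlen
      (fun j => (hstep j).1)
    have hdown := le_one_add_inv_pow_mul hk p (fun j => (q (p j))⁻¹)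
      (fun j => (inv_pos.2 (hpq j)).le) hlen (fun j => by
        rw [← div_eq_mul_inv, le_div_iff₀ (hpq _), inv_mul_le_iff₀ (hpq _), mul_comm]
        exact (hstep j).2)
    simp only [hp0, hpk] at hup hdown
    refine ⟨hup, ?_⟩
    rwa [← div_eq_mul_inv, le_div_iff₀ (hpos x hx), inv_mul_le_iff₀ (hpos y hy), mul_comm] at hdown
  have hall : ∀ y₁ ∈ Set.Icc (0:ℝ) 1, ∀ y₂ ∈ Set.Icc (0:ℝ) 1,
      q y₂ ≤ (1 + 1 / (k : ℝ)) ^ k * q y₁ := by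
    intro y₁ h₁ y₂ h₂
    rcases le_total y₁ y₂ with h | h
    · exact (hbound y₁ h₁ y₂ h₂ h).1
    · exact (hbound y₂ h₂ y₁ h₁ h).2
  refine ⟨hall, ?_⟩
  have hcomp : IsCompact (q '' Set.Icc 0 1) := isCompact_Icc.image_of_continuousOn hcont
  have hne : (q '' Set.Icc (0:ℝ) 1).Nonempty := (Set.nonempty_Icc.2 zero_le_one).image q
  obtain ⟨u, hu, hu'⟩ := hcomp.sInf_mem hne
  obtain ⟨v, hv, hv'⟩ := hcomp.sSup_mem hne
  rw [← hu', ← hv', div_le_iff₀ (hpos u hu)]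
  exact hall u hu v hv
end

section
/- A phantom mechanism that does not always place a phantom at each endpoint has unbounded approximation ratio for total and maximum cost. That is, let n ≥ 1 and let p_1 ≤ … ≤ p_{n+1} be values in [0,1], and let f(x) be the median (the (n+1)-th smallest) of the 2n+1 numbers x_1,…,x_n,p_1,…,p_{n+1}. If p_i < 1 for all i, then for the profile x with x_i = 1 for all i and for every scaling function q : [0,1] → ℝ with q > 0: f(x) < 1, so TC(q, f(x), x) > 0 and MC(q, f(x), x) > 0, while min_{y∈[0,1]} TC(q, y, x) = min_{y∈[0,1]} MC(q, y, x) = 0. Symmetrically, if p_i > 0 for all i, the same conclusion holds for the profile with all agents at 0 (with f(x) > 0). -/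
theorem medOf_eq_of_perm {l l' : List ℝ} (h : l.Perm l') (hs : l'.Pairwise (· ≤ ·)) :
    medOf l = l'.getD (l'.length / 2) 0 := by
  have hsort : List.insertionSort (· ≤ ·) l = l' :=
    ((List.perm_insertionSort _ l).trans h).eq_of_pairwise'
      (List.pairwise_insertionSort _ l) hs
  rw [medOf, hsort, h.length_eq]

theorem medOf_const_append_of_le {n : ℕ} {p : Fin (n + 2) → ℝ} (hp : Monotone p) {c : ℝ}
    (hc : ∀ i, p i ≤ c) :
    medOf (List.ofFn (fun _ : Fin (n + 1) => c) ++ List.ofFn p) = p (Fin.last (n + 1)) := by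
  have hs : (List.ofFn p ++ List.ofFn (fun _ : Fin (n + 1) => c)).Pairwise (· ≤ ·) := by
    refine List.pairwise_append.2 ⟨List.pairwise_ofFn.2 fun i j h => hp h.le,
      List.pairwise_ofFn.2 fun _ _ _ => le_rfl, fun a ha b hb => ?_⟩
    obtain ⟨i, rfl⟩ := List.mem_ofFn.1 ha
    obtain ⟨_, rfl⟩ := List.mem_ofFn.1 hb
    exact hc i
  have hlen : (n + 2 + (n + 1)) / 2 = n + 1 := by omega
  rw [medOf_eq_of_perm List.perm_append_comm hs, List.length_append, List.length_ofFn,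
    List.length_ofFn, hlen, List.getD_append _ _ _ _ (by simp), List.getD_eq_getElem _ _ (by simp),
    List.getElem_ofFn]
  rfl

theorem medOf_const_append_of_ge {n : ℕ} {p : Fin (n + 2) → ℝ} (hp : Monotone p) {c : ℝ}
    (hc : ∀ i, c ≤ p i) :
    medOf (List.ofFn (fun _ : Fin (n + 1) => c) ++ List.ofFn p) = p 0 := by
  have hs : (List.ofFn (fun _ : Fin (n + 1) => c) ++ List.ofFn p).Pairwise (· ≤ ·) := by
    refine List.pairwise_append.2 ⟨List.pairwise_ofFn.2 fun _ _ _ => le_rfl,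
      List.pairwise_ofFn.2 fun i j h => hp h.le, fun a ha b hb => ?_⟩
    obtain ⟨_, rfl⟩ := List.mem_ofFn.1 ha
    obtain ⟨i, rfl⟩ := List.mem_ofFn.1 hb
    exact hc i
  have hlen : (n + 1 + (n + 2)) / 2 = n + 1 := by omega
  rw [medOf_eq_of_perm (List.Perm.refl _) hs, List.length_append, List.length_ofFn,
    List.length_ofFn, hlen, List.getD_append_right _ _ _ _ (by simp), List.length_ofFn,
    Nat.sub_self, List.getD_eq_getElem _ _ (by simp), List.getElem_ofFn]
  rfl

theorem sInf_image_eq_zero {s : Set ℝ} {g : ℝ → ℝ} {c : ℝ} (hc : c ∈ s) (hgc : g c = 0)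
    (hg : ∀ y ∈ s, 0 ≤ g y) : sInf (g '' s) = 0 :=
  IsLeast.csInf_eq ⟨⟨c, hc, hgc⟩, Set.forall_mem_image.2 hg⟩

theorem cost_of_unanimous_profile (n : ℕ) {q : ℝ → ℝ} {s : Set ℝ} (hq : ∀ y ∈ s, 0 < q y)
    {c m : ℝ} (hc : c ∈ s) (hm : m ∈ s) (hmc : m ≠ c) :
    0 < q m * ∑ _i : Fin (n + 1), |m - c| ∧
    0 < q m * (Finset.univ.sup' Finset.univ_nonempty fun _i : Fin (n + 1) => |m - c|) ∧
    sInf ((fun y => q y * ∑ _i : Fin (n + 1), |y - c|) '' s) = 0 ∧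
    sInf ((fun y => q y *
      (Finset.univ.sup' Finset.univ_nonempty fun _i : Fin (n + 1) => |y - c|)) '' s) = 0 := by
  have habs : 0 < |m - c| := abs_pos.2 (sub_ne_zero.2 hmc)
  simp only [Finset.sup'_const]
  refine ⟨mul_pos (hq m hm) (Finset.sum_pos (fun _ _ => habs) Finset.univ_nonempty),
    mul_pos (hq m hm) habs, sInf_image_eq_zero hc (by simp) fun y hy => ?_,
    sInf_image_eq_zero hc (by simp) fun y hy => ?_⟩
  · exact mul_nonneg (hq y hy).le (Finset.sum_nonneg fun _ _ => abs_nonneg _)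
  · exact mul_nonneg (hq y hy).le (abs_nonneg _)

/-- A phantom mechanism (median of `n+1 ≥ 1` agents and `n+2` sorted phantoms
`p₀ ≤ … ≤ p_{n+1}` in `[0,1]`) that does not always place a phantom at each endpoint has
unbounded approximation ratio for total and maximum cost. If all `pᵢ < 1`, then on the
profile with all agents at `1`, for every positive scaling function `q`: the facility is
strictly left of `1`, so the total cost and maximum cost are positive, while the minima over
`[0,1]` of both objectives are `0`. Symmetrically if all `pᵢ > 0`, with all agents at `0`. -/
theorem stmt_15 (n : ℕ) (p : Fin (n+2) → ℝ) (hp : Monotone p)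
    (hp01 : ∀ i, p i ∈ Set.Icc (0:ℝ) 1) :
    ((∀ i, p i < 1) →
      ∀ q : ℝ → ℝ, (∀ y ∈ Set.Icc (0:ℝ) 1, 0 < q y) →
        medOf (List.ofFn (fun _ : Fin (n+1) => (1:ℝ)) ++ List.ofFn p) < 1 ∧
        0 < q (medOf (List.ofFn (fun _ : Fin (n+1) => (1:ℝ)) ++ List.ofFn p)) *
              ∑ _i : Fin (n+1),
                |medOf (List.ofFn (fun _ : Fin (n+1) => (1:ℝ)) ++ List.ofFn p) - 1| ∧
        0 < q (medOf (List.ofFn (fun _ : Fin (n+1) => (1:ℝ)) ++ List.ofFn p)) *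
              (Finset.univ.sup' Finset.univ_nonempty fun _i : Fin (n+1) =>
                |medOf (List.ofFn (fun _ : Fin (n+1) => (1:ℝ)) ++ List.ofFn p) - 1|) ∧
        sInf ((fun y => q y * ∑ _i : Fin (n+1), |y - 1|) '' Set.Icc 0 1) = 0 ∧
        sInf ((fun y => q y *
          (Finset.univ.sup' Finset.univ_nonempty fun _i : Fin (n+1) => |y - 1|)) ''
            Set.Icc 0 1) = 0) ∧
    ((∀ i, 0 < p i) →
      ∀ q : ℝ → ℝ, (∀ y ∈ Set.Icc (0:ℝ) 1, 0 < q y) →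
        0 < medOf (List.ofFn (fun _ : Fin (n+1) => (0:ℝ)) ++ List.ofFn p) ∧
        0 < q (medOf (List.ofFn (fun _ : Fin (n+1) => (0:ℝ)) ++ List.ofFn p)) *
              ∑ _i : Fin (n+1),
                |medOf (List.ofFn (fun _ : Fin (n+1) => (0:ℝ)) ++ List.ofFn p) - 0| ∧
        0 < q (medOf (List.ofFn (fun _ : Fin (n+1) => (0:ℝ)) ++ List.ofFn p)) *
              (Finset.univ.sup' Finset.univ_nonempty fun _i : Fin (n+1) =>
                |medOf (List.ofFn (fun _ : Fin (n+1) => (0:ℝ)) ++ List.ofFn p) - 0|) ∧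
        sInf ((fun y => q y * ∑ _i : Fin (n+1), |y - 0|) '' Set.Icc 0 1) = 0 ∧
        sInf ((fun y => q y *
          (Finset.univ.sup' Finset.univ_nonempty fun _i : Fin (n+1) => |y - 0|)) ''
            Set.Icc 0 1) = 0) := by
  refine ⟨fun h q hq => ?_, fun h q hq => ?_⟩
  · rw [medOf_const_append_of_le hp fun i => (h i).le]
    exact ⟨h _, cost_of_unanimous_profile n hq (by simp) (hp01 _) (h _).ne⟩
  · rw [medOf_const_append_of_ge hp fun i => (h i).le]
    exact ⟨h _, cost_of_unanimous_profile n hq (by simp) (hp01 _) (h _).ne'⟩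
end
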